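/- Let p ∈ ℕ*, a₁,…,a_p ∈ ℝ and λ > 0, and suppose that max(a₁,0) + ⋯ + max(a_p,0) < 1. Then the discrete-time Hawkes chain with memory p is geometrically ergodic: there exists a probability measure π on ℕ^p invariant under the transition kernel P, a constant ρ ∈ (0,1) and a function C : ℕ^p → [0,∞) such that for every state x ∈ ℕ^p and every n ∈ ℕ, the total variation distance between the n-step transition law P^n(x,·) and π is at most C(x)·ρ^n. -/

import Mathlib

open scoped BigOperators
open Classical

/-- The Poisson probability mass function with parameter `s` at `k`
(with the convention that a Poisson variable of parameter `0` is identically `0`,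
which is consistent since `0 ^ 0 = 1`). -/
noncomputable def poissonPMF (s : ℝ) (k : ℕ) : ℝ :=
  Real.exp (-s) * s ^ k / (Nat.factorial k)

/-- The (truncated) intensity `s_x = max(a₁x₁ + ⋯ + a_p x_p + λ, 0)`. -/
noncomputable def hawkesS {p : ℕ} (a : Fin p → ℝ) (lam : ℝ) (x : Fin p → ℕ) : ℝ :=
  max (∑ i, a i * (x i : ℝ) + lam) 0

/-- Transition kernel of the discrete-time Hawkes chain with memory `p`:
from `x = (x₁,…,x_p)` the chain moves to `(ℓ, x₁,…,x_{p−1})` with `ℓ`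
Poisson distributed with parameter `s_x`. -/
noncomputable def hawkesP {p : ℕ} (hp : 0 < p) (a : Fin p → ℝ) (lam : ℝ)
    (x y : Fin p → ℕ) : ℝ :=
  if ∀ i : Fin p, ∀ h : (i : ℕ) + 1 < p, y ⟨(i : ℕ) + 1, h⟩ = x i
  then poissonPMF (hawkesS a lam x) (y ⟨0, hp⟩) else 0

/-- `n`-step transition kernel of a Markov kernel `P` on a countable state space. -/
noncomputable def kernelPow {S : Type*} (P : S → S → ℝ) : ℕ → S → S → ℝ
  | 0 => fun x y => if x = y then 1 else 0
  | n + 1 => fun x y => ∑' z, kernelPow P n x z * P z y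

/-- Total variation distance between two (sub)probability vectors on a countable space. -/
noncomputable def tvDist {S : Type*} (μ ν : S → ℝ) : ℝ :=
  (1 / 2) * ∑' y, |μ y - ν y|


/-- The operator associated with a kernel. -/
noncomputable def kop {S : Type*} (P : S → S → ℝ) (f : S → ℝ) (x : S) : ℝ := ∑' y, P x y * f y

/-- Markov kernel with a drift condition. -/
structure Drift {S : Type*} (P : S → S → ℝ) (V : S → ℝ) (γ K : ℝ) : Prop where
  nn : ∀ x y, 0 ≤ P x y
  one : ∀ x, HasSum (P x) 1
  sV : ∀ x, Summable fun y => P x y * V y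
  dV : ∀ x, kop P V x ≤ γ * V x + K

/-- Functions bounded by a multiple of `1 + V`. -/
def Good {S : Type*} (V : S → ℝ) (f : S → ℝ) : Prop := ∃ C, 0 ≤ C ∧ ∀ y, |f y| ≤ C * (1 + V y)

section abs
variable {S : Type*} {P Q : S → S → ℝ} {V : S → ℝ} {γ K γ' K' : ℝ}

lemma Drift.sW (h : Drift P V γ K) (x : S) : Summable fun y => P x y * (1 + V y) := by
  have := (h.one x).summable.add (h.sV x)
  refine this.congr fun y => by ring

lemma Drift.summ (h : Drift P V γ K) {f : S → ℝ} (hf : Good V f) (x : S) :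
    Summable fun y => P x y * f y := by
  obtain ⟨C, hC, hf⟩ := hf
  refine Summable.of_norm_bounded ((h.sW x).mul_left C) fun y => ?_
  rw [Real.norm_eq_abs, abs_mul, abs_of_nonneg (h.nn x y)]
  nlinarith [mul_le_mul_of_nonneg_left (hf y) (h.nn x y)]

lemma good_const (hV : ∀ x, 0 ≤ V x) (c : ℝ) : Good V fun _ => c :=
  ⟨|c|, abs_nonneg _, fun y => by nlinarith [abs_nonneg c, hV y]⟩

lemma good_V (hV : ∀ x, 0 ≤ V x) : Good V V :=
  ⟨1, one_pos.le, fun y => by rw [abs_of_nonneg (hV y)]; linarith⟩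

lemma Good.add {f g : S → ℝ} (hf : Good V f) (hg : Good V g) : Good V fun y => f y + g y := by
  obtain ⟨C, hC, hf⟩ := hf
  obtain ⟨D, hD, hg⟩ := hg
  exact ⟨C + D, by positivity, fun y => (abs_add_le _ _).trans (by linarith [hf y, hg y])⟩

lemma Good.smul {f : S → ℝ} (hf : Good V f) (c : ℝ) : Good V fun y => c * f y := by
  obtain ⟨C, hC, hf⟩ := hf
  exact ⟨|c| * C, by positivity, fun y => by
    rw [abs_mul, mul_assoc]; exact mul_le_mul_of_nonneg_left (hf y) (abs_nonneg _)⟩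

lemma Drift.kop_add (h : Drift P V γ K) {f g : S → ℝ} (hf : Good V f) (hg : Good V g) (x : S) :
    kop P (fun y => f y + g y) x = kop P f x + kop P g x := by
  unfold kop
  rw [← (h.summ hf x).tsum_add (h.summ hg x)]
  exact tsum_congr fun y => by ring

lemma kop_smul (f : S → ℝ) (c : ℝ) (x : S) :
    kop P (fun y => c * f y) x = c * kop P f x := by
  unfold kop
  rw [← tsum_mul_left]
  exact tsum_congr fun y => by ring

lemma Drift.kop_const (h : Drift P V γ K) (c : ℝ) (x : S) :
    kop P (fun _ => c) x = c := by
  unfold kop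
  rw [tsum_mul_right, (h.one x).tsum_eq, one_mul]

lemma Drift.kop_mono (h : Drift P V γ K) {f g : S → ℝ} (hf : Good V f) (hg : Good V g)
    (hfg : ∀ y, f y ≤ g y) (x : S) : kop P f x ≤ kop P g x :=
  (h.summ hf x).tsum_le_tsum (fun y => mul_le_mul_of_nonneg_left (hfg y) (h.nn x y)) (h.summ hg x)

lemma Drift.kop_abs (h : Drift P V γ K) {f g : S → ℝ} (hf : Good V f) (hg : Good V g)
    (hfg : ∀ y, |f y| ≤ g y) (x : S) : |kop P f x| ≤ kop P g x := by
  rw [abs_le]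
  have h1 := h.kop_mono hf hg (fun y => (le_abs_self _).trans (hfg y)) x
  have h2 := h.kop_mono (hg.smul (-1)) hf (fun y => by linarith [neg_abs_le (f y), hfg y]) x
  rw [kop_smul] at h2
  constructor <;> linarith

lemma Drift.kop_good (h : Drift P V γ K) (hV : ∀ x, 0 ≤ V x) (hγ : 0 ≤ γ) (hK : 0 ≤ K)
    {f : S → ℝ} (hf : Good V f) : Good V (kop P f) := by
  obtain ⟨C, hC, hf'⟩ := id hf
  refine ⟨C * (1 + γ + K), by positivity, fun x => ?_⟩
  have h1 := h.kop_abs hf (((good_const hV 1).add (good_V hV)).smul C) hf' x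
  rw [kop_smul, h.kop_add (good_const hV 1) (good_V hV), h.kop_const] at h1
  refine h1.trans ?_
  rw [mul_assoc]
  refine mul_le_mul_of_nonneg_left ?_ hC
  have := h.dV x
  nlinarith [hV x, mul_nonneg hγ (hV x), mul_nonneg hK (hV x)]

lemma Drift.prod (hQ : Drift Q V γ' K') (hP : Drift P V γ K) (hV : ∀ x, 0 ≤ V x) (hγ : 0 ≤ γ)
    (hK : 0 ≤ K) {f : S → ℝ} (hf : Good V f) (x : S) :
    Summable fun zy : S × S => Q x zy.1 * P zy.1 zy.2 * f zy.2 := by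
  have hW : Good V fun y => 1 + V y := (good_const hV 1).add (good_V hV)
  have : Summable fun zy : S × S => Q x zy.1 * P zy.1 zy.2 * (1 + V zy.2) := by
    rw [summable_prod_of_nonneg]
    · refine ⟨fun z => ?_, ?_⟩
      · simpa only [mul_assoc] using (hP.summ hW z).mul_left (Q x z)
      · simp only [mul_assoc, tsum_mul_left]
        exact hQ.summ (hP.kop_good hV hγ hK hW) x
    · intro zy
      have := hQ.nn x zy.1
      have := hP.nn zy.1 zy.2
      have := hV zy.2
      simp only [Pi.zero_apply]
      positivity
  obtain ⟨C, hC, hf⟩ := hf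
  refine Summable.of_norm_bounded (this.mul_left C) fun zy => ?_
  have h1 := mul_nonneg (hQ.nn x zy.1) (hP.nn zy.1 zy.2)
  rw [Real.norm_eq_abs, abs_mul, abs_of_nonneg h1]
  nlinarith [mul_le_mul_of_nonneg_left (hf zy.2) h1]

lemma Drift.kop_comp (hQ : Drift Q V γ' K') (hP : Drift P V γ K) (hV : ∀ x, 0 ≤ V x) (hγ : 0 ≤ γ)
    (hK : 0 ≤ K) {f : S → ℝ} (hf : Good V f) (x : S) :
    HasSum (fun y => (∑' z, Q x z * P z y) * f y) (kop Q (kop P f) x) := by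
  have hs := hQ.prod hP hV hγ hK hf x
  have h1 : kop Q (kop P f) x = ∑' zy : S × S, Q x zy.1 * P zy.1 zy.2 * f zy.2 := by
    rw [hs.tsum_prod]
    unfold kop
    exact tsum_congr fun z => by simp only [mul_assoc, tsum_mul_left]
  rw [h1]
  have hs2 := (Equiv.prodComm S S).summable_iff.2 hs
  have h2 := hs2.hasSum.prod_fiberwise fun y => (hs2.prod_factor y).hasSum
  convert h2 using 1
  · funext y
    simp [tsum_mul_right]
  · exact ((Equiv.prodComm S S).tsum_eq (fun zy : S × S => Q x zy.1 * P zy.1 zy.2 * f zy.2)).symm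

lemma Drift.comp (hQ : Drift Q V γ' K') (hP : Drift P V γ K) (hV : ∀ x, 0 ≤ V x) (hγ : 0 ≤ γ)
    (hK : 0 ≤ K) : Drift (fun x y => ∑' z, Q x z * P z y) V (γ * γ') (γ * K' + K) := by
  refine ⟨fun x y => tsum_nonneg fun z => mul_nonneg (hQ.nn _ _) (hP.nn _ _), fun x => ?_,
    fun x => (hQ.kop_comp hP hV hγ hK (good_V hV) x).summable, fun x => ?_⟩
  · have := hQ.kop_comp hP hV hγ hK (good_const hV 1) x
    rw [funext (hP.kop_const 1), hQ.kop_const] at this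
    simpa using this
  · have h0 : kop (fun x y => ∑' z, Q x z * P z y) V x = kop Q (kop P V) x :=
      (hQ.kop_comp hP hV hγ hK (good_V hV) x).tsum_eq
    rw [h0]
    have := hQ.kop_mono (hP.kop_good hV hγ hK (good_V hV))
      (((good_V hV).smul γ).add (good_const hV K)) hP.dV x
    rw [hQ.kop_add ((good_V hV).smul γ) (good_const hV K), kop_smul, hQ.kop_const] at this
    nlinarith [mul_le_mul_of_nonneg_left (hQ.dV x) hγ]

lemma Drift.pow (hP : Drift P V γ K) (hV : ∀ x, 0 ≤ V x) (hγ : 0 ≤ γ) (hγ1 : γ < 1)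
    (hK : 0 ≤ K) (n : ℕ) : Drift (kernelPow P n) V (γ ^ n) (K / (1 - γ)) := by
  have hd : (0:ℝ) < 1 - γ := by linarith
  induction n with
  | zero =>
    have key : ∀ (f : S → ℝ) x, HasSum (fun y => kernelPow P 0 x y * f y) (f x) := by
      intro f x
      have := hasSum_single (f := fun y => kernelPow P 0 x y * f y) x
        (fun y hy => by simp [kernelPow, hy.symm])
      simpa [kernelPow] using this
    refine ⟨fun x y => ?_, fun x => ?_, fun x => (key V x).summable, fun x => ?_⟩
    · simp only [kernelPow]; split_ifs <;> norm_num
    · simpa using key (fun _ => 1) x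
    · have h1 : kop (kernelPow P 0) V x = V x := (key V x).tsum_eq
      have : 0 ≤ K / (1 - γ) := by positivity
      rw [h1]; linarith
  | succ n ih =>
    have := ih.comp hP hV hγ hK
    have e : γ * (K / (1 - γ)) + K = K / (1 - γ) := by field_simp; ring
    rw [e, ← pow_succ'] at this
    exact this

lemma Drift.kop_pow (hP : Drift P V γ K) (hV : ∀ x, 0 ≤ V x) (hγ : 0 ≤ γ) (hγ1 : γ < 1)
    (hK : 0 ≤ K) (n : ℕ) {f : S → ℝ} (hf : Good V f) :
    kop (kernelPow P n) f = (kop P)^[n] f := by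
  induction n generalizing f with
  | zero =>
    funext x
    simp only [kernelPow, kop, Function.iterate_zero, id]
    rw [tsum_eq_single x]
    · simp
    · intro y hy; simp [hy.symm]
  | succ n ih =>
    rw [Function.iterate_succ_apply, ← ih (hP.kop_good hV hγ hK hf)]
    funext x
    exact ((hP.pow hV hγ hγ1 hK n).kop_comp hP hV hγ hK hf x).tsum_eq

end abs

section contr
variable {S : Type*} {P Q : S → S → ℝ} {V : S → ℝ} {γ K γ' K' : ℝ}

/-- Weighted Lipschitz condition. -/
def WLip (V : S → ℝ) (β D : ℝ) (f : S → ℝ) : Prop :=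
  ∀ x y, |f x - f y| ≤ D * ((1 + β * V x) + (1 + β * V y))

lemma WLip.center {β D : ℝ} {f : S → ℝ} (h : WLip V β D f) [Nonempty S] :
    ∃ c, ∀ z, |f z - c| ≤ D * (1 + β * V z) := by
  have hb : ∀ x y, f x - D * (1 + β * V x) ≤ f y + D * (1 + β * V y) := fun x y => by
    have := (abs_le.1 (h x y)).2
    linarith
  obtain ⟨o⟩ := id ‹Nonempty S›
  have hbdd : BddAbove (Set.range fun x => f x - D * (1 + β * V x)) :=
    ⟨f o + D * (1 + β * V o), by rintro _ ⟨x, rfl⟩; exact hb x o⟩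
  refine ⟨⨆ x, (f x - D * (1 + β * V x)), fun z => ?_⟩
  have h1 := le_ciSup hbdd z
  have h2 : (⨆ x, (f x - D * (1 + β * V x))) ≤ f z + D * (1 + β * V z) := ciSup_le fun x => hb x z
  rw [abs_le]; constructor <;> linarith

lemma good_W (hV : ∀ x, 0 ≤ V x) (β : ℝ) : Good V fun z => 1 + β * V z :=
  (good_const hV 1).add ((good_V hV).smul β)

lemma Drift.kop_W (hQ : Drift Q V γ K) (hV : ∀ x, 0 ≤ V x) {β : ℝ} (hβ : 0 ≤ β) (x : S) :
    kop Q (fun z => 1 + β * V z) x ≤ 1 + β * (γ * V x + K) := by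
  rw [hQ.kop_add (good_const hV 1) ((good_V hV).smul β), hQ.kop_const, kop_smul]
  have := mul_le_mul_of_nonneg_left (hQ.dV x) hβ
  linarith

/-- Basic comparison of two rows. -/
lemma Drift.two_rows (hQ : Drift Q V γ K) (hV : ∀ x, 0 ≤ V x) {β : ℝ} (hβ : 0 ≤ β)
    {g : S → ℝ} (D : ℝ) (hD : 0 ≤ D) (hg : ∀ z, |g z| ≤ D * (1 + β * V z))
    (x y o : S) {η : ℝ} (hη : 0 ≤ η) (hx : η ≤ Q x o) (hy : η ≤ Q y o) :
    |kop Q g x - kop Q g y| ≤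
      D * (2 + β * (γ * (V x + V y) + 2 * K) - 2 * η) := by
  have hgg : Good V g := by
    refine ⟨D * (1 + β), by positivity, fun z => (hg z).trans ?_⟩
    rw [mul_assoc]
    refine mul_le_mul_of_nonneg_left ?_ hD
    nlinarith [hV z]
  have hW := good_W hV β
  have hs1 := hQ.summ hW x
  have hs2 := hQ.summ hW y
  have hsg := (hQ.summ hgg x).sub (hQ.summ hgg y)
  have hso : HasSum (fun z => if z = o then 2 * η * (1 + β * V o) else 0)
      (2 * η * (1 + β * V o)) := hasSum_ite_eq o _
  have hsR : HasSum (fun z => D * (Q x z * (1 + β * V z) + Q y z * (1 + β * V z)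
      - if z = o then 2 * η * (1 + β * V o) else 0))
      (D * (kop Q (fun z => 1 + β * V z) x + kop Q (fun z => 1 + β * V z) y
        - 2 * η * (1 + β * V o))) :=
    ((hs1.hasSum.add hs2.hasSum).sub hso).mul_left D
  have e : kop Q g x - kop Q g y = ∑' z, (Q x z * g z - Q y z * g z) :=
    ((hQ.summ hgg x).tsum_sub (hQ.summ hgg y)).symm
  have hb : ∀ z, ‖Q x z * g z - Q y z * g z‖ ≤ D * (Q x z * (1 + β * V z) + Q y z * (1 + β * V z)
      - if z = o then 2 * η * (1 + β * V o) else 0) := by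
    intro z
    have hw : 0 ≤ 1 + β * V z := by have := hV z; positivity
    have h1 : |Q x z - Q y z| * (1 + β * V z) ≤ (Q x z * (1 + β * V z) + Q y z * (1 + β * V z)
      - if z = o then 2 * η * (1 + β * V o) else 0) := by
      split_ifs with hz
      · subst hz
        have : |Q x z - Q y z| ≤ Q x z + Q y z - 2 * η := by
          rw [abs_le]; constructor <;> linarith
        nlinarith [mul_le_mul_of_nonneg_right this hw]
      · have : |Q x z - Q y z| ≤ Q x z + Q y z := by
          have := hQ.nn x z
          have := hQ.nn y z
          rw [abs_le]; constructor <;> linarith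
        nlinarith [mul_le_mul_of_nonneg_right this hw]
    rw [← sub_mul, Real.norm_eq_abs, abs_mul]
    calc |Q x z - Q y z| * |g z| ≤ |Q x z - Q y z| * (D * (1 + β * V z)) :=
          mul_le_mul_of_nonneg_left (hg z) (abs_nonneg _)
      _ = D * (|Q x z - Q y z| * (1 + β * V z)) := by ring
      _ ≤ _ := mul_le_mul_of_nonneg_left h1 hD
  have h2 := tsum_of_norm_bounded hsR hb
  rw [← e, Real.norm_eq_abs] at h2
  refine h2.trans (mul_le_mul_of_nonneg_left ?_ hD)
  have h3 := hQ.kop_W hV hβ x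
  have h4 := hQ.kop_W hV hβ y
  have h5 : 0 ≤ 2 * η * (β * V o) := by have := hV o; positivity
  linarith

lemma Drift.kop_shift (hQ : Drift Q V γ K) (hV : ∀ x, 0 ≤ V x) {f : S → ℝ} (hf : Good V f)
    (c : ℝ) (x : S) : kop Q (fun z => f z - c) x = kop Q f x - c := by
  have := hQ.kop_add hf (good_const hV (-c)) x
  rw [hQ.kop_const] at this
  simpa [sub_eq_add_neg] using this

/-- Lipschitz growth. -/
lemma Drift.lip_grow (hQ : Drift Q V γ K) (hV : ∀ x, 0 ≤ V x) (hγ : 0 ≤ γ) (hγ1 : γ ≤ 1)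
    (hK : 0 ≤ K) {β : ℝ} (hβ : 0 ≤ β)
    {f : S → ℝ} (hf : Good V f) (D : ℝ) (hD : 0 ≤ D) (hL : WLip V β D f) :
    WLip V β ((1 + β * K) * D) (kop Q f) := by
  intro x y
  have : Nonempty S := ⟨x⟩
  obtain ⟨c, hc⟩ := hL.center
  have h := hQ.two_rows hV hβ D hD hc x y x le_rfl (hQ.nn _ _) (hQ.nn _ _)
  rw [hQ.kop_shift hV hf, hQ.kop_shift hV hf, sub_sub_sub_cancel_right] at h
  refine h.trans ?_
  rw [mul_comm (1 + β * K) D, mul_assoc]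
  refine mul_le_mul_of_nonneg_left ?_ hD
  have := hV x
  have := hV y
  have h1 : 0 ≤ β * K * (β * (V x + V y)) := by positivity
  have h2 : 0 ≤ β * ((1 - γ) * (V x + V y)) :=
    mul_nonneg hβ (mul_nonneg (by linarith) (by linarith))
  nlinarith

/-- Harris contraction. -/
lemma Drift.lip_contract (hQ : Drift Q V γ K) (hV : ∀ x, 0 ≤ V x) (hγ : 0 ≤ γ) (hγ1 : γ < 1)
    (hK : 0 ≤ K) (o : S) (hmin : ∀ R : ℝ, ∃ α > 0, ∀ x, V x ≤ R → α ≤ Q x o) :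
    ∃ β θ : ℝ, 0 < β ∧ 0 < θ ∧ θ < 1 ∧ ∀ (f : S → ℝ) (D : ℝ), Good V f → 0 ≤ D → WLip V β D f →
      WLip V β (θ * D) (kop Q f) := by
  obtain ⟨α, hα, hmin⟩ := hmin ((4 * K + 4) / (1 - γ))
  have hg : 0 < 1 - γ := by linarith
  obtain ⟨β, hβ⟩ : ∃ β, β = α / (2 * (K + 1)) := ⟨_, rfl⟩
  have hβ0 : 0 < β := by rw [hβ]; positivity
  have hβ1 : β * (2 * (K + 1)) = α := by rw [hβ]; field_simp
  have h1 : min β ((1 - γ) / 2) ≤ β := min_le_left _ _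
  have h2 : min β ((1 - γ) / 2) ≤ (1 - γ) / 2 := min_le_right _ _
  have h3 : 0 < min β ((1 - γ) / 2) := lt_min hβ0 (by linarith)
  generalize min β ((1 - γ) / 2) = δ at h1 h2 h3
  refine ⟨β, 1 - δ, hβ0, by linarith, by linarith, fun f D hf hD hL x y => ?_⟩
  have : Nonempty S := ⟨x⟩
  obtain ⟨c, hc⟩ := hL.center
  have hVx := hV x
  have hVy := hV y
  have hbs : 0 ≤ β * (V x + V y) := by positivity
  suffices hh : ∃ η, 0 ≤ η ∧ η ≤ Q x o ∧ η ≤ Q y o ∧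
      2 + β * (γ * (V x + V y) + 2 * K) - 2 * η ≤ (1 - δ) * (2 + β * (V x + V y)) by
    obtain ⟨η, h0, hx, hy, hle⟩ := hh
    have h := hQ.two_rows hV hβ0.le D hD hc x y o h0 hx hy
    rw [hQ.kop_shift hV hf, hQ.kop_shift hV hf, sub_sub_sub_cancel_right] at h
    refine h.trans ?_
    nlinarith [mul_le_mul_of_nonneg_left hle hD]
  by_cases hR : V x + V y ≤ (4 * K + 4) / (1 - γ)
  · refine ⟨α, hα.le, hmin x (by linarith), hmin y (by linarith), ?_⟩
    nlinarith [mul_nonneg hbs (by linarith : (0:ℝ) ≤ 1 - γ - δ)]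
  · refine ⟨0, le_rfl, hQ.nn _ _, hQ.nn _ _, ?_⟩
    push Not at hR
    rw [div_lt_iff₀ hg] at hR
    have h4 : 0 ≤ β * (V x + V y) * ((1 - γ) / 2 - δ) := mul_nonneg hbs (by linarith)
    have h5 := mul_le_mul_of_nonneg_left hR.le hβ0.le
    nlinarith

lemma Drift.iter_good (hP : Drift P V γ K) (hV : ∀ x, 0 ≤ V x) (hγ : 0 ≤ γ) (hK : 0 ≤ K) (n : ℕ)
    {f : S → ℝ} (hf : Good V f) : Good V ((kop P)^[n] f) := by
  induction n with
  | zero => exact hf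
  | succ n ih => rw [Function.iterate_succ_apply']; exact hP.kop_good hV hγ hK ih

lemma geo_aux {θ : ℝ} (h0 : 0 < θ) (h1 : θ < 1) {m : ℕ} (hm : 0 < m) :
    ∃ C ρ : ℝ, 0 < C ∧ 0 < ρ ∧ ρ < 1 ∧ ∀ n : ℕ, θ ^ (n / m) ≤ C * ρ ^ n := by
  obtain ⟨ρ, hρ⟩ : ∃ ρ, ρ = θ ^ ((m:ℝ)⁻¹) := ⟨_, rfl⟩
  have hρ0 : 0 < ρ := by rw [hρ]; positivity
  have hρ1 : ρ < 1 := by rw [hρ]; exact Real.rpow_lt_one h0.le h1 (by positivity)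
  have e : ρ ^ m = θ := by rw [hρ]; exact Real.rpow_inv_natCast_pow h0.le hm.ne'
  refine ⟨(ρ ^ m)⁻¹, ρ, by positivity, hρ0, hρ1, fun n => ?_⟩
  rw [inv_mul_eq_div, le_div_iff₀ (by positivity), ← e, ← pow_mul, ← pow_add]
  refine pow_le_pow_of_le_one hρ0.le hρ1.le ?_
  have := Nat.div_add_mod n m
  have := Nat.mod_lt n hm
  omega

lemma Drift.lip_iter (hP : Drift P V γ K) (hV : ∀ x, 0 ≤ V x) (hγ : 0 ≤ γ) (hγ1 : γ < 1)
    (hK : 0 ≤ K) (o : S) (m : ℕ) (hm : 0 < m)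
    (hmin : ∀ R : ℝ, ∃ α > 0, ∀ x, V x ≤ R → α ≤ kernelPow P m x o) :
    ∃ β C ρ : ℝ, 0 < β ∧ 0 < C ∧ 0 < ρ ∧ ρ < 1 ∧ ∀ (f : S → ℝ), (∀ y, |f y| ≤ 1) → ∀ n,
      WLip V β (C * ρ ^ n) ((kop P)^[n] f) := by
  have hd : (0:ℝ) < 1 - γ := by linarith
  obtain ⟨β, θ, hβ, hθ0, hθ1, hc⟩ := (hP.pow hV hγ hγ1 hK m).lip_contract hV (by positivity)
    (pow_lt_one₀ hγ hγ1 hm.ne') (by positivity) o hmin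
  obtain ⟨C, ρ, hC, hρ0, hρ1, hg⟩ := geo_aux hθ0 hθ1 hm
  have hL : 1 ≤ 1 + β * K := by nlinarith [mul_nonneg hβ.le hK]
  refine ⟨β, (1 + β * K) ^ m * C, ρ, hβ, by positivity, hρ0, hρ1, fun f hf n => ?_⟩
  have hfg : Good V f := ⟨1, one_pos.le, fun y => by linarith [hf y, hV y]⟩
  have hf1 : WLip V β 1 f := fun x y => by
    have h1 : 0 ≤ β * V x := mul_nonneg hβ.le (hV x)
    have h2 : 0 ≤ β * V y := mul_nonneg hβ.le (hV y)
    have := (abs_sub (f x) (f y)).trans (add_le_add (hf x) (hf y))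
    linarith
  have hr : ∀ r, WLip V β ((1 + β * K) ^ r) ((kop P)^[r] f) := by
    intro r
    induction r with
    | zero => simpa using hf1
    | succ r ih =>
      rw [Function.iterate_succ_apply', pow_succ']
      exact hP.lip_grow hV hγ hγ1.le hK hβ.le (hP.iter_good hV hγ hK r hfg) _ (by positivity) ih
  have hk : ∀ r k, WLip V β (θ ^ k * (1 + β * K) ^ r) ((kop P)^[m * k + r] f) := by
    intro r k
    induction k with
    | zero => simpa using hr r
    | succ k ih =>
      have := hc _ _ (hP.iter_good hV hγ hK _ hfg) (by positivity) ih
      rw [hP.kop_pow hV hγ hγ1 hK m (hP.iter_good hV hγ hK _ hfg),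
        ← Function.iterate_add_apply] at this
      rw [pow_succ', mul_assoc, show m * (k + 1) + r = m + (m * k + r) by ring]
      exact this
  have := hk (n % m) (n / m)
  rw [Nat.div_add_mod] at this
  intro x y
  refine (this x y).trans (mul_le_mul_of_nonneg_right ?_ ?_)
  · have h1 : (1 + β * K) ^ (n % m) ≤ (1 + β * K) ^ m :=
      pow_le_pow_right₀ hL (Nat.mod_lt n hm).le
    calc θ ^ (n / m) * (1 + β * K) ^ (n % m) ≤ (C * ρ ^ n) * (1 + β * K) ^ m :=
          mul_le_mul (hg n) h1 (by positivity) (by positivity)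
      _ = _ := by ring
  · have h1 : 0 ≤ β * V x := mul_nonneg hβ.le (hV x)
    have h2 : 0 ≤ β * V y := mul_nonneg hβ.le (hV y)
    linarith

/-- Conversion of weak bounds into total variation bounds. -/
lemma l1_of_weak {μ ν : S → ℝ} (hμ : Summable μ) (hν : Summable ν) {B : ℝ}
    (h : ∀ f : S → ℝ, (∀ y, |f y| ≤ 1) → |∑' y, μ y * f y - ∑' y, ν y * f y| ≤ B) :
    ∑' y, |μ y - ν y| ≤ B := by
  let f : S → ℝ := fun y => if ν y ≤ μ y then 1 else -1
  have hf : ∀ y, |f y| ≤ 1 := fun y => by simp only [f]; split_ifs <;> norm_num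
  have key : ∀ ξ : S → ℝ, Summable ξ → Summable fun y => ξ y * f y := fun ξ hξ =>
    Summable.of_norm_bounded hξ.abs fun y => by
      rw [Real.norm_eq_abs, abs_mul]
      exact mul_le_of_le_one_right (abs_nonneg _) (hf y)
  have h1 := h f hf
  rw [← (key μ hμ).tsum_sub (key ν hν)] at h1
  refine le_trans (le_of_eq ?_) ((le_abs_self _).trans h1)
  refine tsum_congr fun y => ?_
  simp only [f]
  split_ifs with hy
  · rw [abs_of_nonneg (by linarith)]; ring
  · rw [abs_of_nonpos (by linarith)]; ring

theorem harris (hP : Drift P V γ K) (hV : ∀ x, 0 ≤ V x) (hγ : 0 ≤ γ) (hγ1 : γ < 1)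
    (hK : 0 ≤ K) (o : S) (m : ℕ) (hm : 0 < m)
    (hmin : ∀ R : ℝ, ∃ α > 0, ∀ x, V x ≤ R → α ≤ kernelPow P m x o) :
    ∃ π : S → ℝ,
      (∀ x, 0 ≤ π x) ∧ (∑' x, π x = 1) ∧
      (∀ y, ∑' x, π x * P x y = π y) ∧
      ∃ ρ : ℝ, ρ ∈ Set.Ioo (0 : ℝ) 1 ∧
        ∃ C : S → ℝ, (∀ x, 0 ≤ C x) ∧
          ∀ (x : S) (n : ℕ), tvDist (kernelPow P n x) π ≤ C x * ρ ^ n := by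
  have hd : (0:ℝ) < 1 - γ := by linarith
  obtain ⟨β, C, ρ, hβ, hC, hρ0, hρ1, hL⟩ := hP.lip_iter hV hγ hγ1 hK o m hm hmin
  have hpw := fun n => hP.pow hV hγ hγ1 hK n
  have hgood : ∀ f : S → ℝ, (∀ y, |f y| ≤ 1) → Good V f := fun f hf =>
    ⟨1, one_pos.le, fun y => by linarith [hf y, hV y]⟩
  have hρt : Filter.Tendsto (fun n => ρ ^ n) Filter.atTop (nhds 0) :=
    tendsto_pow_atTop_nhds_zero_of_lt_one hρ0.le hρ1
  -- bounds
  have A1 : ∀ x y n, ∑' z, |kernelPow P n x z - kernelPow P n y z| ≤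
      C * ρ ^ n * ((1 + β * V x) + (1 + β * V y)) := by
    intro x y n
    refine l1_of_weak ((hpw n).one x).summable ((hpw n).one y).summable fun f hf => ?_
    have h := hL f hf n x y
    rw [← hP.kop_pow hV hγ hγ1 hK n (hgood f hf)] at h
    exact h
  let B : S → ℝ := fun x => C * (2 * (1 + β * V x) + β * (K / (1 - γ)))
  have hB : ∀ x, 0 ≤ B x := fun x => by have := hV x; simp only [B]; positivity
  have A2 : ∀ x n k, ∑' z, |kernelPow P (k + n) x z - kernelPow P n x z| ≤ B x * ρ ^ n := by
    intro x n k
    refine l1_of_weak ((hpw _).one x).summable ((hpw n).one x).summable fun f hf => ?_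
    have hg := hP.iter_good hV hγ hK n (hgood f hf)
    have e1 : ∑' y, kernelPow P (k + n) x y * f y
        = kop (kernelPow P k) ((kop P)^[n] f) x := by
      rw [hP.kop_pow hV hγ hγ1 hK k hg, ← Function.iterate_add_apply,
        ← hP.kop_pow hV hγ hγ1 hK _ (hgood f hf)]
      rfl
    have e2 : ∑' y, kernelPow P n x y * f y = (kop P)^[n] f x := by
      rw [← hP.kop_pow hV hγ hγ1 hK _ (hgood f hf)]
      rfl
    rw [e1, e2, ← (hpw k).kop_shift hV hg]
    have h1 := (hpw k).kop_abs (f := fun z => (kop P)^[n] f z - (kop P)^[n] f x)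
      (g := fun z => (C * ρ ^ n) * ((1 + β * V z) + (1 + β * V x)))
      (by simpa [sub_eq_add_neg] using hg.add (good_const hV (-((kop P)^[n] f x))))
      (((good_W hV β).add (good_const hV _)).smul _) (fun z => hL f hf n z x) x
    refine h1.trans ?_
    rw [kop_smul, (hpw k).kop_add (good_W hV β) (good_const hV _), (hpw k).kop_const]
    have h2 := (hpw k).kop_W hV hβ.le x
    have h3 : γ ^ k * V x ≤ V x := mul_le_of_le_one_left (hV x) (pow_le_one₀ hγ hγ1.le)
    have h4 := mul_le_mul_of_nonneg_left h3 hβ.le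
    have h5 : B x * ρ ^ n = C * ρ ^ n * (2 * (1 + β * V x) + β * (K / (1 - γ))) := by
      simp only [B]; ring
    rw [h5]
    refine mul_le_mul_of_nonneg_left ?_ (by positivity)
    linarith
  have sab : ∀ n x k y, Summable fun z => |kernelPow P n x z - kernelPow P k y z| :=
    fun n x k y => (((hpw n).one x).summable.sub ((hpw k).one y).summable).abs
  have A2' : ∀ x n k z, |kernelPow P (k + n) x z - kernelPow P n x z| ≤ B x * ρ ^ n :=
    fun x n k z => ((sab _ _ _ _).le_tsum z fun _ _ => abs_nonneg _).trans (A2 x n k)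
  have A1' : ∀ x y n z, |kernelPow P n x z - kernelPow P n y z| ≤
      C * ρ ^ n * ((1 + β * V x) + (1 + β * V y)) :=
    fun x y n z => ((sab _ _ _ _).le_tsum z fun _ _ => abs_nonneg _).trans (A1 x y n)
  have hlim0 : ∀ z, ∃ l, Filter.Tendsto (fun n => kernelPow P n o z) Filter.atTop (nhds l) := by
    intro z
    refine cauchySeq_tendsto_of_complete ?_
    refine cauchySeq_of_le_tendsto_0 (fun n => 2 * (B o * ρ ^ n)) (fun i j N hi hj => ?_) ?_
    · obtain ⟨i, rfl⟩ := Nat.exists_eq_add_of_le' hi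
      obtain ⟨j, rfl⟩ := Nat.exists_eq_add_of_le' hj
      rw [Real.dist_eq]
      have h1 := abs_le.1 (A2' o N i z)
      have h2 := abs_le.1 (A2' o N j z)
      rw [abs_le]; constructor <;> linarith
    · simpa using (hρt.const_mul (B o)).const_mul 2
  choose π hπ using hlim0
  have hlim : ∀ x z, Filter.Tendsto (fun n => kernelPow P n x z) Filter.atTop (nhds (π z)) := by
    intro x z
    have h1 : Filter.Tendsto (fun n => kernelPow P n x z - kernelPow P n o z)
        Filter.atTop (nhds 0) := by
      refine squeeze_zero_norm (fun n => A1' x o n z) ?_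
      simpa using (hρt.const_mul C).mul_const ((1 + β * V x) + (1 + β * V o))
    simpa using h1.add (hπ z)
  have hfin : ∀ x n (F : Finset S), ∑ z ∈ F, |kernelPow P n x z - π z| ≤ B x * ρ ^ n := by
    intro x n F
    have h1 : Filter.Tendsto (fun k => ∑ z ∈ F, |kernelPow P n x z - kernelPow P (k + n) x z|)
        Filter.atTop (nhds (∑ z ∈ F, |kernelPow P n x z - π z|)) :=
      tendsto_finsetSum _ fun z _ =>
        (((Filter.tendsto_add_atTop_iff_nat n).2 (hlim x z)).const_sub _).abs
    refine le_of_tendsto' h1 fun k => ?_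
    refine le_trans ?_ (A2 x n k)
    simp_rw [abs_sub_comm (kernelPow P n x _)]
    exact (sab _ _ _ _).sum_le_tsum F fun _ _ => abs_nonneg _
  have hsd : ∀ x n, Summable fun z => |kernelPow P n x z - π z| := fun x n =>
    summable_of_sum_le (fun _ => abs_nonneg _) (hfin x n)
  have htv : ∀ x n, ∑' z, |kernelPow P n x z - π z| ≤ B x * ρ ^ n := fun x n =>
    (hsd x n).tsum_le_of_sum_le (hfin x n)
  have hπ0 : ∀ z, 0 ≤ π z := fun z => ge_of_tendsto' (hπ z) fun n => (hpw n).nn o z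
  have hπs : Summable π := by
    have := ((hpw 0).one o).summable.sub (hsd o 0).of_abs
    simpa using this
  have P1 : ∀ z y, P z y ≤ 1 := fun z y =>
    (hP.one z).tsum_eq ▸ (hP.one z).summable.le_tsum y fun _ _ => hP.nn _ _
  -- test functions bounded by one
  have htest : ∀ f : S → ℝ, (∀ y, |f y| ≤ 1) →
      Filter.Tendsto (fun n => ∑' z, kernelPow P n o z * f z) Filter.atTop
        (nhds (∑' z, π z * f z)) := by
    intro f hf
    have key : ∀ ξ : S → ℝ, Summable ξ → Summable fun y => ξ y * f y := fun ξ hξ =>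
      Summable.of_norm_bounded hξ.abs fun y => by
        rw [Real.norm_eq_abs, abs_mul]
        exact mul_le_of_le_one_right (abs_nonneg _) (hf y)
    rw [tendsto_iff_norm_sub_tendsto_zero]
    refine squeeze_zero (fun _ => norm_nonneg _) (fun n => ?_)
      (by simpa using hρt.const_mul (B o))
    rw [← (key _ ((hpw n).one o).summable).tsum_sub (key _ hπs)]
    refine (tsum_of_norm_bounded (hsd o n).hasSum fun z => ?_).trans (htv o n)
    rw [← sub_mul, Real.norm_eq_abs, abs_mul]
    exact mul_le_of_le_one_right (abs_nonneg _) (hf z)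
  refine ⟨π, hπ0, ?_, fun y => ?_, ρ, ⟨hρ0, hρ1⟩, fun x => B x / 2, fun x => by
    have := hB x; positivity, fun x n => ?_⟩
  · have h1 := htest (fun _ => 1) (by simp)
    simp only [mul_one, ((hpw _).one o).tsum_eq] at h1
    exact tendsto_nhds_unique h1 tendsto_const_nhds
  · have h1 := htest (fun z => P z y) (fun z => by rw [abs_of_nonneg (hP.nn _ _)]; exact P1 z y)
    exact tendsto_nhds_unique h1 ((Filter.tendsto_add_atTop_iff_nat 1).2 (hπ y))
  · unfold tvDist
    linarith [htv x n]

end contr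

section hawkes

lemma hasSum_poissonPMF (s : ℝ) : HasSum (poissonPMF s) 1 := by
  have h := NormedSpace.expSeries_div_hasSum_exp s
  rw [← congr_fun Real.exp_eq_exp_ℝ s] at h
  have h2 := h.mul_left (Real.exp (-s))
  rw [← Real.exp_add, neg_add_cancel, Real.exp_zero] at h2
  convert! h2 using 1
  funext k
  simp only [poissonPMF]; ring

lemma hasSum_poissonPMF_mean (s : ℝ) : HasSum (fun k : ℕ => poissonPMF s k * k) s := by
  rw [hasSum_nat_add_iff' 1 |>.symm]
  have h := (hasSum_poissonPMF s).mul_left s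
  simp only [Finset.range_one, Finset.sum_singleton, Nat.cast_zero, mul_zero, sub_zero]
  rw [mul_one] at h
  convert! h using 1
  funext k
  simp only [poissonPMF, Nat.factorial_succ]
  push_cast
  field_simp
  ring

lemma poissonPMF_nonneg {s : ℝ} (hs : 0 ≤ s) (k : ℕ) : 0 ≤ poissonPMF s k := by
  unfold poissonPMF; positivity

variable {q : ℕ}

/-- Next state. -/
def push (x : Fin (q + 1) → ℕ) (l : ℕ) : Fin (q + 1) → ℕ :=
  Fin.cons l (fun i : Fin q => x i.castSucc)

lemma hawkesP_push (hp : 0 < q + 1) (a : Fin (q + 1) → ℝ) (lam : ℝ) (x : Fin (q + 1) → ℕ) (l : ℕ) :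
    hawkesP hp a lam x (push x l) = poissonPMF (hawkesS a lam x) l := by
  unfold hawkesP
  rw [if_pos]
  · rfl
  · intro i h
    rfl

lemma hawkesP_eq_zero (hp : 0 < q + 1) (a : Fin (q + 1) → ℝ) (lam : ℝ) (x y : Fin (q + 1) → ℕ)
    (hy : y ∉ Set.range (push x)) : hawkesP hp a lam x y = 0 := by
  unfold hawkesP
  rw [if_neg]
  intro h
  refine hy ⟨y 0, ?_⟩
  funext i
  refine Fin.cases rfl (fun j => ?_) i
  exact (h j.castSucc (by simp)).symm

lemma push_inj (x : Fin (q + 1) → ℕ) : Function.Injective (push x) := by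
  intro l l' h
  exact congr_fun h 0

lemma hawkes_hasSum (hp : 0 < q + 1) (a : Fin (q + 1) → ℝ) (lam : ℝ) (x : Fin (q + 1) → ℕ)
    (f : (Fin (q + 1) → ℕ) → ℝ) (A : ℝ)
    (h : HasSum (fun l => poissonPMF (hawkesS a lam x) l * f (push x l)) A) :
    HasSum (fun y => hawkesP hp a lam x y * f y) A := by
  rw [← (push_inj x).hasSum_iff]
  · convert h using 1
    funext l
    simp [hawkesP_push]
  · intro y hy
    rw [hawkesP_eq_zero hp a lam x y hy, zero_mul]

lemma iter_push_zero (x : Fin (q + 1) → ℕ) (k : ℕ) :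
    ∀ i : Fin (q + 1), (i : ℕ) < k → ((fun z => push z 0)^[k] x) i = 0 := by
  induction k with
  | zero => intro i hi; omega
  | succ k ih =>
    intro i
    rw [Function.iterate_succ_apply']
    refine Fin.cases (fun _ => rfl) (fun j hj => ?_) i
    exact ih j.castSucc (by simpa using hj)

/-- Lyapunov weights. -/
noncomputable def bw (c : Fin (q + 1) → ℝ) (k : ℕ) : ℝ := ∑ i : Fin (q + 1), if k ≤ i then c i else 0

lemma bw_succ (c : Fin (q + 1) → ℝ) (i : Fin (q + 1)) : bw c i = c i + bw c (i + 1) := by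
  have : c i = ∑ j : Fin (q + 1), if j = i then c j else 0 := by simp
  unfold bw
  conv_rhs => rw [this]
  rw [← Finset.sum_add_distrib]
  refine Finset.sum_congr rfl fun j _ => ?_
  have : j = i ↔ (j : ℕ) = i := Fin.ext_iff
  simp only [this]
  split_ifs <;> first | omega | simp

lemma bw_nonneg (c : Fin (q + 1) → ℝ) (hc : ∀ i, 0 ≤ c i) (k : ℕ) : 0 ≤ bw c k :=
  Finset.sum_nonneg fun i _ => by split_ifs; exacts [hc i, le_rfl]

lemma bw_le (c : Fin (q + 1) → ℝ) (hc : ∀ i, 0 ≤ c i) (k : ℕ) : bw c k ≤ ∑ i, c i :=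
  Finset.sum_le_sum fun i _ => by split_ifs; exacts [le_rfl, hc i]

lemma bw_last (c : Fin (q + 1) → ℝ) : bw c (q + 1) = 0 :=
  Finset.sum_eq_zero fun i _ => by rw [if_neg]; omega

/-- Lyapunov function. -/
noncomputable def lyap (c : Fin (q + 1) → ℝ) (x : Fin (q + 1) → ℕ) : ℝ :=
  ∑ i : Fin (q + 1), bw c i * x i

lemma lyap_push (c : Fin (q + 1) → ℝ) (x : Fin (q + 1) → ℕ) (l : ℕ) :
    lyap c (push x l) = bw c 0 * l + ∑ i : Fin (q + 1), bw c (i + 1) * x i := by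
  unfold lyap
  rw [Fin.sum_univ_succ, Fin.sum_univ_castSucc (n := q) (f := fun i => bw c (i + 1) * x i)]
  simp [push, bw_last]

theorem hawkes_main (hp : 0 < q + 1) (a : Fin (q + 1) → ℝ)
    (lam : ℝ) (hlam : 0 < lam)
    (hsum : ∑ i, max (a i) 0 < 1) :
    ∃ π : (Fin (q + 1) → ℕ) → ℝ,
      (∀ x, 0 ≤ π x) ∧ (∑' x, π x = 1) ∧
      (∀ y, ∑' x, π x * hawkesP hp a lam x y = π y) ∧
      ∃ ρ : ℝ, ρ ∈ Set.Ioo (0 : ℝ) 1 ∧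
        ∃ C : (Fin (q + 1) → ℕ) → ℝ, (∀ x, 0 ≤ C x) ∧
          ∀ (x : Fin (q + 1) → ℕ) (n : ℕ),
            tvDist (kernelPow (hawkesP hp a lam) n x) π ≤ C x * ρ ^ n := by
  obtain ⟨ε, hε⟩ : ∃ ε, ε = (1 - ∑ i, max (a i) 0) / ((q + 1 : ℕ) : ℝ) := ⟨_, rfl⟩
  have hε0 : 0 < ε := by rw [hε]; exact div_pos (by linarith) (by positivity)
  have hε1 : ((q + 1 : ℕ) : ℝ) * ε = 1 - ∑ i, max (a i) 0 := by rw [hε]; field_simp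
  obtain ⟨c, hc⟩ : ∃ c : Fin (q + 1) → ℝ, c = fun i => max (a i) 0 + ε := ⟨_, rfl⟩
  have hc0 : ∀ i, 0 ≤ c i := fun i => by
    rw [hc]; have := le_max_right (a i) 0; simp only; linarith
  have hcs : ∑ i, c i = 1 := by
    rw [hc, Finset.sum_add_distrib]
    simp only [Finset.sum_const, Finset.card_univ, Fintype.card_fin, nsmul_eq_mul]
    linarith
  have hεle : ε ≤ 1 := by
    have h1 : c 0 ≤ ∑ i, c i := Finset.single_le_sum (fun i _ => hc0 i) (Finset.mem_univ 0)
    rw [hcs, hc] at h1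
    have := le_max_right (a 0) 0
    simp only at h1
    linarith
  have hb0 : bw c 0 = 1 := by rw [← hcs]; simp [bw]
  have hb1 : ∀ k, bw c k ≤ 1 := fun k => hcs ▸ bw_le c hc0 k
  have hbn := bw_nonneg c hc0
  have hV : ∀ x, 0 ≤ lyap c x := fun x =>
    Finset.sum_nonneg fun i _ => mul_nonneg (hbn _) (Nat.cast_nonneg _)
  -- key pointwise inequality
  have hS : ∀ x, hawkesS a lam x + ∑ i : Fin (q + 1), bw c (i + 1) * x i
      ≤ (1 - ε) * lyap c x + lam := by
    intro x
    have h1 : hawkesS a lam x ≤ ∑ i, max (a i) 0 * (x i : ℝ) + lam := by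
      unfold hawkesS
      refine max_le ?_ ?_
      · refine add_le_add (Finset.sum_le_sum fun i _ => ?_) le_rfl
        exact mul_le_mul_of_nonneg_right (le_max_left _ _) (Nat.cast_nonneg _)
      · have : 0 ≤ ∑ i, max (a i) 0 * (x i : ℝ) := Finset.sum_nonneg fun i _ =>
          mul_nonneg (le_max_right _ _) (Nat.cast_nonneg _)
        linarith
    have h2 : ∑ i, max (a i) 0 * (x i : ℝ) + ∑ i : Fin (q + 1), bw c (i + 1) * x i
        ≤ (1 - ε) * lyap c x := by
      unfold lyap
      rw [← Finset.sum_add_distrib, Finset.mul_sum]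
      refine Finset.sum_le_sum fun i _ => ?_
      have h3 := bw_succ c i
      have h4 : c i = max (a i) 0 + ε := by rw [hc]
      have h5 := hb1 i
      rw [← add_mul, ← mul_assoc]
      refine mul_le_mul_of_nonneg_right ?_ (Nat.cast_nonneg _)
      nlinarith
    linarith
  have hSn : ∀ x, 0 ≤ hawkesS a lam x := fun x => le_max_right _ _
  have hWn : ∀ x : Fin (q + 1) → ℕ, 0 ≤ ∑ i : Fin (q + 1), bw c (i + 1) * x i := fun x =>
    Finset.sum_nonneg fun i _ => mul_nonneg (hbn _) (Nat.cast_nonneg _)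
  have hle : ∀ x, (1 - ε) * lyap c x ≤ lyap c x := fun x => by nlinarith [hV x]
  have hVs : ∀ x, HasSum (fun y => hawkesP hp a lam x y * lyap c y)
      (hawkesS a lam x + ∑ i : Fin (q + 1), bw c (i + 1) * x i) := by
    intro x
    apply hawkes_hasSum
    have := (hasSum_poissonPMF_mean (hawkesS a lam x)).add
      ((hasSum_poissonPMF (hawkesS a lam x)).mul_right (∑ i : Fin (q + 1), bw c (i + 1) * x i))
    rw [one_mul] at this
    convert this using 1
    funext l
    rw [lyap_push, hb0]; ring
  have hP : Drift (hawkesP hp a lam) (lyap c) (1 - ε) lam := by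
    refine ⟨fun x y => ?_, fun x => ?_, fun x => (hVs x).summable, fun x => ?_⟩
    · unfold hawkesP
      split_ifs
      · exact poissonPMF_nonneg (hSn x) _
      · exact le_rfl
    · have := hawkes_hasSum hp a lam x (fun _ => 1) 1
        (by simpa using hasSum_poissonPMF (hawkesS a lam x))
      simpa using this
    · exact (hVs x).tsum_eq.le.trans (hS x)
  refine harris hP hV (by linarith) (by linarith) hlam.le (fun _ => 0) (q + 1) hp fun R => ?_
  refine ⟨Real.exp (-(R + lam)) ^ (q + 1), by positivity, fun x hx => ?_⟩
  have hpath : ∀ k, lyap c ((fun z => push z 0)^[k] x) ≤ R ∧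
      Real.exp (-(R + lam)) ^ k ≤
        kernelPow (hawkesP hp a lam) k x ((fun z => push z 0)^[k] x) := by
    intro k
    induction k with
    | zero => simpa [kernelPow] using hx
    | succ k ih =>
      obtain ⟨ih1, ih2⟩ := ih
      rw [Function.iterate_succ_apply']
      generalize (fun z => push z 0)^[k] x = y at ih1 ih2
      have hSy := hS y
      have := hle y
      have := hWn y
      have := hSn y
      constructor
      · have h1 := lyap_push c y 0
        rw [Nat.cast_zero, mul_zero, zero_add] at h1
        have h2 : ∑ i : Fin (q + 1), bw c (i + 1) * (y i : ℝ) ≤ lyap c y := by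
          refine Finset.sum_le_sum fun i _ => mul_le_mul_of_nonneg_right ?_ (Nat.cast_nonneg _)
          linarith [bw_succ c i, hc0 i]
        linarith
      · have hk := hP.pow hV (by linarith) (by linarith) hlam.le k
        have hs : Summable fun z => kernelPow (hawkesP hp a lam) k x z *
            hawkesP hp a lam z (push y 0) := by
          refine Summable.of_nonneg_of_le (fun z => mul_nonneg (hk.nn _ _) (hP.nn _ _))
            (fun z => ?_) (hk.one x).summable
          refine mul_le_of_le_one_right (hk.nn _ _) ?_
          exact (hP.one z).tsum_eq ▸ (hP.one z).summable.le_tsum _ fun _ _ => hP.nn _ _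
        have h1 := hs.le_tsum y fun z _ => mul_nonneg (hk.nn _ _) (hP.nn _ _)
        refine le_trans ?_ h1
        rw [pow_succ]
        refine mul_le_mul ih2 ?_ (by positivity) (hk.nn _ _)
        rw [hawkesP_push]
        simp only [poissonPMF, pow_zero, Nat.factorial_zero, Nat.cast_one, mul_one, div_one]
        exact Real.exp_le_exp.2 (by linarith)
  have := (hpath (q + 1)).2
  rwa [show (fun z => push z 0)^[q + 1] x = fun _ => 0 from
    funext fun i => iter_push_zero x (q + 1) i i.2] at this

end hawkes

/-- If `(a₁)₊ + ⋯ + (a_p)₊ < 1`, then the discrete-time Hawkes chain with memory `p`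
is geometrically ergodic: there is an invariant probability measure `π`, a rate
`ρ ∈ (0,1)` and a constant `C(x) ≥ 0` such that the `n`-step law from `x` is within
total variation distance `C(x) ρ^n` of `π`. -/
theorem hawkes_geometrically_ergodic (p : ℕ) (hp : 0 < p) (a : Fin p → ℝ)
    (lam : ℝ) (hlam : 0 < lam)
    (hsum : ∑ i, max (a i) 0 < 1) :
    ∃ π : (Fin p → ℕ) → ℝ,
      (∀ x, 0 ≤ π x) ∧ (∑' x, π x = 1) ∧
      (∀ y, ∑' x, π x * hawkesP hp a lam x y = π y) ∧
      ∃ ρ : ℝ, ρ ∈ Set.Ioo (0 : ℝ) 1 ∧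
        ∃ C : (Fin p → ℕ) → ℝ, (∀ x, 0 ≤ C x) ∧
          ∀ (x : Fin p → ℕ) (n : ℕ),
            tvDist (kernelPow (hawkesP hp a lam) n x) π ≤ C x * ρ ^ n := by
  obtain ⟨q, rfl⟩ : ∃ q, p = q + 1 := ⟨p - 1, by omega⟩
  exact hawkes_main hp a lam hlam hsum
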